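/- Let s ≥ 1 and n ≥ 3s + 3 be integers and let 𝒟(n,s) be the 3-graph on [n] whose edge set is the union of all 3-subsets of [3s+1] with all triples {1, i, x} for 3s+2 ≤ i ≤ n and 2 ≤ x ≤ 3s+1. Then ν(𝒟(n,s)) = s, e(𝒟(n,s)) = binom(3s+1, 3) + 3s(n − 3s − 1), and 𝒟(n,s) is not a subgraph of D^3_{n,s}, i.e., there is no vertex set U of size 3s+2 containing all edges of 𝒟(n,s). -/

import Mathlib

open Finset

/-- A family of finsets is a matching if its members are pairwise disjoint. -/
def IsMatchingFam {α : Type*} [DecidableEq α] (M : Finset (Finset α)) : Prop :=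
  (M : Set (Finset α)).Pairwise Disjoint

/-- The 3-graph `𝒟(n,s)` on vertex set `[n] = {1,…,n}`: all 3-subsets of `[3s+1]` together
with all triples `{1, i, x}` for `3s+2 ≤ i ≤ n` and `2 ≤ x ≤ 3s+1`. -/
def calD (n s : ℕ) : Finset (Finset ℕ) :=
  Finset.powersetCard 3 (Finset.Icc 1 (3 * s + 1)) ∪
    (Finset.Icc (3 * s + 2) n).biUnion
      (fun i => (Finset.Icc 2 (3 * s + 1)).image (fun x => ({1, i, x} : Finset ℕ)))

theorem mem_calD {n s : ℕ} {e : Finset ℕ} :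
    e ∈ calD n s ↔ (e ⊆ Icc 1 (3 * s + 1) ∧ e.card = 3) ∨
      ∃ i ∈ Icc (3 * s + 2) n, ∃ x ∈ Icc 2 (3 * s + 1), ({1, i, x} : Finset ℕ) = e := by
  simp only [calD, mem_union, mem_powersetCard, mem_biUnion, mem_image]

/-- The total intersection of a matching with a set is at most the size of the set. -/
theorem IsMatchingFam.sum_card_inter_le {α : Type*} [DecidableEq α] {M : Finset (Finset α)}
    (hM : IsMatchingFam M) (A : Finset α) : ∑ e ∈ M, (e ∩ A).card ≤ A.card := by
  rw [← card_biUnion (s := M) (t := fun e => e ∩ A)]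
  · exact card_le_card (biUnion_subset.2 fun e _ => inter_subset_right)
  · intro a ha b hb hab
    exact (hM ha hb hab).mono inter_subset_left inter_subset_left

theorem three_le_weight_of_mem_calD {n s : ℕ} {e : Finset ℕ} (he : e ∈ calD n s) :
    3 ≤ (e ∩ Icc 1 (3 * s + 1)).card + (e ∩ {1}).card := by
  rcases mem_calD.1 he with ⟨hsub, hcard⟩ | ⟨i, hi, x, hx, rfl⟩
  · rw [inter_eq_left.2 hsub, hcard]
    omega
  · rw [mem_Icc] at hx
    have h1 : ({1, x} : Finset ℕ) ⊆ {1, i, x} ∩ Icc 1 (3 * s + 1) := by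
      intro y hy
      simp only [mem_insert, mem_singleton, mem_inter, mem_Icc] at hy ⊢
      omega
    have h2 : ({1} : Finset ℕ) ⊆ {1, i, x} ∩ {1} := by simp
    have h3 := card_le_card h1
    have h4 := card_le_card h2
    rw [card_pair (by omega)] at h3
    rw [card_singleton] at h4
    omega

theorem card_le_of_isMatchingFam_calD {n s : ℕ} {M : Finset (Finset ℕ)} (hsub : M ⊆ calD n s)
    (hM : IsMatchingFam M) : M.card ≤ s := by
  have h : ∑ _e ∈ M, 3 ≤ ∑ e ∈ M, ((e ∩ Icc 1 (3 * s + 1)).card + (e ∩ {1}).card) :=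
    sum_le_sum fun e he => three_le_weight_of_mem_calD (hsub he)
  rw [sum_const, smul_eq_mul, sum_add_distrib] at h
  have h1 := hM.sum_card_inter_le (Icc 1 (3 * s + 1))
  have h2 := hM.sum_card_inter_le {1}
  rw [Nat.card_Icc] at h1
  rw [card_singleton] at h2
  omega

theorem exists_isMatchingFam_calD (n s : ℕ) :
    ∃ M ⊆ calD n s, IsMatchingFam M ∧ M.card = s := by
  have key : ∀ k l y : ℕ, y ∈ Icc (3 * k + 1) (3 * k + 3) → y ∈ Icc (3 * l + 1) (3 * l + 3) →
      k = l := by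
    intro k l y hk hl
    rw [mem_Icc] at hk hl
    omega
  refine ⟨(range s).image fun k => Icc (3 * k + 1) (3 * k + 3), ?_, ?_, ?_⟩
  · intro e he
    obtain ⟨k, hk, rfl⟩ := mem_image.1 he
    rw [mem_range] at hk
    refine mem_calD.2 (Or.inl ⟨Icc_subset_Icc (by omega) (by omega), ?_⟩)
    rw [Nat.card_Icc]
    omega
  · intro a ha b hb hab
    obtain ⟨k, -, rfl⟩ := mem_image.1 (mem_coe.1 ha)
    obtain ⟨l, -, rfl⟩ := mem_image.1 (mem_coe.1 hb)
    refine disjoint_left.2 fun y hy hy' => hab ?_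
    rw [key k l y hy hy']
  · rw [card_image_of_injective, card_range]
    intro k l hkl
    have hk : 3 * k + 1 ∈ Icc (3 * k + 1) (3 * k + 3) := mem_Icc.2 (by omega)
    exact key k l _ hk ((Finset.ext_iff.1 hkl _).1 hk)

theorem eq_of_triple_eq {m i j x y : ℕ} (hm : 1 ≤ m) (hi : m < i) (hj : m < j)
    (hx : x ∈ Icc 2 m) (hy : y ∈ Icc 2 m)
    (h : ({1, i, x} : Finset ℕ) = {1, j, y}) : i = j ∧ x = y := by
  rw [mem_Icc] at hx hy
  have h1 := (Finset.ext_iff.1 h i).1 (by simp)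
  have h2 := (Finset.ext_iff.1 h x).1 (by simp)
  simp only [mem_insert, mem_singleton] at h1 h2
  omega

theorem card_calD (n s : ℕ) :
    (calD n s).card = (3 * s + 1).choose 3 + 3 * s * (n - 3 * s - 1) := by
  rw [calD, card_union_of_disjoint, card_powersetCard, Nat.card_Icc, card_biUnion]
  · congr 1
    rw [sum_congr rfl (g := fun _ => 3 * s), sum_const, Nat.card_Icc, smul_eq_mul, mul_comm]
    · congr 1
      omega
    · intro i hi
      rw [mem_Icc] at hi
      rw [card_image_of_injOn, Nat.card_Icc]
      · omega
      · intro x hx y hy h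
        exact (eq_of_triple_eq (by omega) (by omega) (by omega) hx hy h).2
  · intro i hi j hj hij
    rw [mem_coe, mem_Icc] at hi hj
    refine disjoint_left.2 fun e he he' => hij ?_
    obtain ⟨x, hx, rfl⟩ := mem_image.1 he
    obtain ⟨y, hy, h⟩ := mem_image.1 he'
    exact (eq_of_triple_eq (by omega) (by omega) (by omega) hy hx h).1.symm
  · refine disjoint_left.2 fun e he he' => ?_
    obtain ⟨i, hi, hi'⟩ := mem_biUnion.1 he'
    obtain ⟨x, -, rfl⟩ := mem_image.1 hi'
    have h := (mem_powersetCard.1 he).1 (show i ∈ ({1, i, x} : Finset ℕ) by simp)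
    rw [mem_Icc] at hi h
    omega

theorem Icc_subset_of_forall_mem_calD_subset {n s : ℕ} (hs : 1 ≤ s) (hn : 3 * s + 2 ≤ n)
    {U : Finset ℕ} (hU : ∀ e ∈ calD n s, e ⊆ U) : Icc 1 n ⊆ U := by
  have key : ∀ i ∈ Icc (3 * s + 2) n, ∀ x ∈ Icc 2 (3 * s + 1), ({1, i, x} : Finset ℕ) ⊆ U :=
    fun i hi x hx => hU _ (mem_calD.2 (Or.inr ⟨i, hi, x, hx, rfl⟩))
  have hi₀ : 3 * s + 2 ∈ Icc (3 * s + 2) n := mem_Icc.2 (by omega)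
  have hx₀ : 2 ∈ Icc 2 (3 * s + 1) := mem_Icc.2 (by omega)
  intro v hv
  rw [mem_Icc] at hv
  by_cases hlarge : 3 * s + 2 ≤ v
  · exact key v (mem_Icc.2 ⟨hlarge, hv.2⟩) 2 hx₀ (by simp)
  · by_cases hone : v = 1
    · exact key _ hi₀ 2 hx₀ (by simp [hone])
    · exact key _ hi₀ v (mem_Icc.2 (by omega)) (by simp)

/-- `𝒟(n,s)` has matching number exactly `s`, exactly `binom(3s+1,3) + 3s(n-3s-1)` edges,
and is not a subgraph of `D³_{n,s}`. -/
theorem calD_properties (n s : ℕ) (hs : 1 ≤ s) (hn : 3 * s + 3 ≤ n) :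
    (∀ M ⊆ calD n s, IsMatchingFam M → M.card ≤ s) ∧
    (∃ M ⊆ calD n s, IsMatchingFam M ∧ M.card = s) ∧
    (calD n s).card = (3 * s + 1).choose 3 + 3 * s * (n - 3 * s - 1) ∧
    ¬ ∃ U : Finset ℕ, U.card = 3 * s + 2 ∧ ∀ e ∈ calD n s, e ⊆ U := by
  refine ⟨fun M => card_le_of_isMatchingFam_calD, exists_isMatchingFam_calD n s, card_calD n s, ?_⟩
  rintro ⟨U, hcard, hU⟩
  have h := card_le_card (Icc_subset_of_forall_mem_calD_subset hs (by omega) hU)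
  rw [Nat.card_Icc] at h
  omega
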